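/- Let θ ∈ O(q,k) be an involution of block form (τ_{U,a}, Y, ρ), where τ_{U,a} = τ_{u_l,a_l} ∘ ⋯ ∘ τ_{u_1,a_1} is a product of symplectic transvections of V_B with u₁, …, u_l linearly independent and pairwise B-orthogonal and all a_i ≠ 0, Y : V_B → rad(V) is linear, and ρ : rad(V) → rad(V). Then θ can be written as a product θ = Θ₁ ∘ Θ₂ ∘ Θ₃ of three elements of O(q,k), where: Θ₁ = τ_{u'_l} ∘ ⋯ ∘ τ_{u'_1} is a product of orthogonal transvections with respect to vectors u'₁, …, u'_l ∈ V satisfying q(u'_i) = 1/a_i; Θ₂ ∈ O(q,k) satisfies Θ₂(v) + v ∈ rad(V) and q(Θ₂(v) + v) = 0 for all v ∈ V and restricts to the identity on rad(V); and Θ₃ ∈ O(q,k) restricts to the identity on V_B and to ρ on rad(V). -/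

import Mathlib

open QuadraticMap

/-- The symplectic transvection `τ_{u,a} : w ↦ w + a·B(u,w)·u`, where `B = polar Q` is the
bilinear form associated to the quadratic form `Q`. -/
noncomputable def sympTransvection {k V : Type*} [Field k] [AddCommGroup V] [Module k V]
    (Q : QuadraticForm k V) (u : V) (a : k) : Module.End k V :=
  LinearMap.id + a • (polarBilin Q u).smulRight u

/-- The orthogonal transvection `τ_u : w ↦ w + (B(u,w)/Q(u))·u` (for `Q u ≠ 0`). -/
noncomputable def orthTransvection {k V : Type*} [Field k] [AddCommGroup V] [Module k V]
    (Q : QuadraticForm k V) (u : V) : Module.End k V :=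
  sympTransvection Q u (Q u)⁻¹

/-- The radical `rad(V) = {v | ∀ w, B(v,w) = 0}` of the bilinear form associated to `Q`. -/
def qRadical {k V : Type*} [Field k] [AddCommGroup V] [Module k V]
    (Q : QuadraticForm k V) : Submodule k V where
  carrier := {v | ∀ w, polar Q v w = 0}
  add_mem' := by
    intro a b ha hb w
    rw [polar_add_left, ha, hb, add_zero]
  zero_mem' := fun w => polar_zero_left Q w
  smul_mem' := by
    intro c v hv w
    rw [polar_smul_left, hv, smul_zero]

/-- The block map `(φ, X, δ) : V → V`, `w + g ↦ φ(w) + X(w) + δ(g)` for `w ∈ V_B`,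
`g ∈ R`, relative to a decomposition `V = V_B ⊕ R`. -/
noncomputable def tripleMap {k V : Type*} [Field k] [AddCommGroup V] [Module k V]
    (VB RD : Submodule k V) (hc : IsCompl VB RD)
    (φ : VB →ₗ[k] VB) (X : VB →ₗ[k] RD) (δ : RD →ₗ[k] RD) : V →ₗ[k] V :=
  VB.subtype ∘ₗ φ ∘ₗ VB.linearProjOfIsCompl RD hc
    + RD.subtype ∘ₗ (X ∘ₗ VB.linearProjOfIsCompl RD hc + δ ∘ₗ RD.linearProjOfIsCompl VB hc.symm)

/-- A linearly independent family in a finite-dimensional space carrying a nondegenerate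
polar form admits a dual family. -/
theorem exists_dual_family_of_nondegenerate {k W : Type*} [Field k] [AddCommGroup W] [Module k W]
    [FiniteDimensional k W] (Q : QuadraticForm k W)
    (hQ : ∀ v, (∀ w, polar Q v w = 0) → v = 0)
    {ι : Type*} [DecidableEq ι] (u : ι → W) (hu : LinearIndependent k u) :
    ∃ d : ι → W, ∀ i j, polar Q (u j) (d i) = if i = j then 1 else 0 := by
  obtain ⟨f, hf⟩ := LinearMap.exists_leftInverse_of_injective
    (Finsupp.linearCombination k u) (LinearMap.ker_eq_bot.2 hu)
  have hinj : Function.Injective (polarBilin Q : W →ₗ[k] Module.Dual k W) := by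
    rw [← LinearMap.ker_eq_bot, LinearMap.ker_eq_bot']
    exact fun v hv => hQ v fun w => LinearMap.congr_fun hv w
  have hsurj : Function.Surjective (polarBilin Q : W →ₗ[k] Module.Dual k W) :=
    (LinearMap.injective_iff_surjective_of_finrank_eq_finrank
      Subspace.dual_finrank_eq.symm).1 hinj
  choose d hd using fun i => hsurj (Finsupp.lapply i ∘ₗ f)
  refine ⟨d, fun i j => ?_⟩
  have hfu : f (u j) = Finsupp.single j 1 := by
    simpa using LinearMap.congr_fun hf (Finsupp.single j 1)
  have h := LinearMap.congr_fun (hd i) (u j)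
  rw [polarBilin_apply_apply] at h
  rw [polar_comm, h]
  simp [hfu, Finsupp.single_apply, eq_comm]

section

variable {k V : Type*} [Field k] [AddCommGroup V] [Module k V]

theorem sympTransvection_apply (Q : QuadraticForm k V) (u : V) (a : k) (v : V) :
    sympTransvection Q u a v = v + (a * polar Q u v) • u := by
  simp [sympTransvection, smul_smul]

theorem prod_sympTransvection_apply (Q : QuadraticForm k V) {l : ℕ} (u : Fin l → V)
    (a : Fin l → k) (hu : ∀ i j, i ≠ j → polar Q (u i) (u j) = 0) (v : V) :
    (List.ofFn fun i => sympTransvection Q (u i) (a i)).reverse.prod v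
      = v + ∑ i, (a i * polar Q (u i) v) • u i := by
  induction l generalizing v with
  | zero => simp
  | succ l ih =>
    have hu0 (i : Fin l) : polar Q (u i.succ) (u 0) = 0 := hu _ _ (Fin.succ_ne_zero i)
    rw [List.ofFn_succ, List.reverse_cons, List.prod_append, List.prod_singleton,
      Module.End.mul_apply, ih (fun i => u i.succ) (fun i => a i.succ)
        fun i j hij => hu _ _ fun h => hij (Fin.succ_injective _ h)]
    simp [sympTransvection_apply, Fin.sum_univ_succ, polar_add_right, polar_smul_right, hu0,
      add_assoc]

/-- A quadratic form is additive on sums of pairwise orthogonal vectors. -/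
theorem map_sum_of_pairwise_orthogonal (Q : QuadraticForm k V) {ι : Type*} (s : Finset ι)
    (f : ι → V) (hf : ∀ i j, i ≠ j → polar Q (f i) (f j) = 0) :
    Q (∑ i ∈ s, f i) = ∑ i ∈ s, Q (f i) := by
  classical
  induction s using Finset.induction_on with
  | empty => simp
  | insert i s hi ih =>
    have h : polar Q (f i) (∑ j ∈ s, f j) = 0 := by
      rw [← polarBilin_apply_apply, map_sum]
      exact Finset.sum_eq_zero fun j hj => hf i j fun hij => hi (hij ▸ hj)
    rw [Finset.sum_insert hi, Finset.sum_insert hi, QuadraticMap.map_add Q, h, ih, add_zero]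

theorem polar_of_mem_qRadical {Q : QuadraticForm k V} {g : V} (hg : g ∈ qRadical Q) (v : V) :
    polar Q g v = 0 :=
  hg v

theorem polar_of_mem_qRadical_right {Q : QuadraticForm k V} {g : V} (hg : g ∈ qRadical Q)
    (v : V) : polar Q v g = 0 := by
  rw [polar_comm, polar_of_mem_qRadical hg]

theorem map_add_of_mem_qRadical {Q : QuadraticForm k V} {g : V} (hg : g ∈ qRadical Q) (v : V) :
    Q (v + g) = Q v + Q g := by
  rw [QuadraticMap.map_add Q, polar_of_mem_qRadical_right hg, add_zero]

theorem tripleMap_apply_add (VB RD : Submodule k V) (hc : IsCompl VB RD)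
    (φ : VB →ₗ[k] VB) (X : VB →ₗ[k] RD) (δ : RD →ₗ[k] RD) (w : VB) (g : RD) :
    tripleMap VB RD hc φ X δ (w + g) = φ w + (X w + δ g : RD) := by
  simp [tripleMap, Submodule.linearProjOfIsCompl]

theorem bijective_of_mul_self_eq_one {f : Module.End k V} (hf : f * f = 1) :
    Function.Bijective f :=
  Function.Involutive.bijective fun v => LinearMap.congr_fun hf v

end

/-- an involution `θ ∈ O(q,k)` of block form `(τ_{U,a}, Y, ρ)`, where
`τ_{U,a}` is a product of symplectic transvections of `V_B`, factors as
`θ = Θ₁ ∘ Θ₂ ∘ Θ₃` with `Θ₁` a product of orthogonal transvections `τ_{u'_i}` with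
`q(u'_i) = 1/a_i`, `Θ₂ ∈ O(q,k)` shifting every vector by a norm-zero radical vector and
fixing `rad(V)`, and `Θ₃ ∈ O(q,k)` the identity on `V_B` and `ρ` on `rad(V)`. -/
theorem involution_block_decomposition
    {k V : Type*} [Field k] [CharP k 2] [AddCommGroup V] [Module k V] [FiniteDimensional k V]
    (Q : QuadraticForm k V) (VB : Submodule k V)
    (hc : IsCompl VB (qRadical Q))
    -- `V_B` is nonsingular
    (hVB : ∀ v ∈ VB, (∀ w ∈ VB, polar Q v w = 0) → v = 0)
    {l : ℕ} (u : Fin l → VB) (a : Fin l → k)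
    (hu : LinearIndependent k u) (ha : ∀ i, a i ≠ 0)
    (huB : ∀ i j, i ≠ j → polar Q ((u i : V)) ((u j : V)) = 0)
    (Y : VB →ₗ[k] qRadical Q) (ρ : qRadical Q →ₗ[k] qRadical Q)
    -- `θ` has block form `(τ_{U,a}, Y, ρ)` with `τ_{U,a} = τ_{u_l,a_l}∘⋯∘τ_{u_1,a_1}`
    (θ : Module.End k V)
    (hθ : θ = tripleMap VB (qRadical Q) hc
      ((List.ofFn fun i => sympTransvection (Q.comp VB.subtype) (u i) (a i)).reverse.prod) Y ρ)
    -- `θ` is an involution in `O(q,k)`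
    (hθbij : Function.Bijective θ) (hθQ : ∀ v, Q (θ v) = Q v)
    (hθ2 : θ * θ = 1) :
    ∃ (u' : Fin l → V) (Θ₂ Θ₃ : Module.End k V),
      (∀ i, Q (u' i) = (a i)⁻¹) ∧
      (Function.Bijective Θ₂ ∧ (∀ v, Q (Θ₂ v) = Q v) ∧
        (∀ v, Θ₂ v + v ∈ qRadical Q ∧ Q (Θ₂ v + v) = 0) ∧
        (∀ g ∈ qRadical Q, Θ₂ g = g)) ∧
      (Function.Bijective Θ₃ ∧ (∀ v, Q (Θ₃ v) = Q v) ∧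
        (∀ w ∈ VB, Θ₃ w = w) ∧ (∀ g : qRadical Q, Θ₃ (g : V) = (ρ g : V))) ∧
      θ = (List.ofFn fun i => orthTransvection Q (u' i)).reverse.prod * Θ₂ * Θ₃ := by
  have key (w : VB) (g : qRadical Q) : θ (w + g) =
      ((w + ∑ i, (a i * polar Q (u i : V) w) • u i : VB) : V) + (Y w + ρ g : qRadical Q) := by
    rw [hθ, tripleMap_apply_add, prod_sympTransvection_apply (Q.comp VB.subtype) u a huB]
    rfl
  have keyR (g : qRadical Q) : θ g = ρ g := by simpa using key 0 g
  have hρ2 (g : qRadical Q) : ρ (ρ g) = g := by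
    have h := LinearMap.congr_fun hθ2 (g : V)
    rw [Module.End.mul_apply, keyR, keyR] at h
    exact Subtype.ext h
  have hρQ (g : qRadical Q) : Q (ρ g) = Q g := by rw [← keyR, hθQ]
  have hYQ (w : VB) : Q (Y w) =
      ∑ i, a i * polar Q (u i : V) w ^ 2 * (1 + a i * Q (u i)) := by
    have h := hθQ w
    have hk := key w 0
    simp only [ZeroMemClass.coe_zero, map_zero, add_zero] at hk
    rw [hk, map_add_of_mem_qRadical (Y w).2, Submodule.coe_add, QuadraticMap.map_add Q,
      AddSubmonoidClass.coe_finsetSum, map_sum_of_pairwise_orthogonal _ _ _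
        (fun i j hij => by simp [polar_smul_left, polar_smul_right, huB i j hij]),
      ← polarBilin_apply_apply, map_sum, add_assoc, add_assoc, add_eq_left, ← add_assoc,
      ← Finset.sum_add_distrib, CharTwo.add_eq_zero] at h
    rw [← h]
    refine Finset.sum_congr rfl fun i _ => ?_
    simp only [Submodule.coe_smul, QuadraticMap.map_smul, polarBilin_apply_apply,
      polar_smul_left, smul_eq_mul, polar_comm Q (w : V)]
    ring
  obtain ⟨d, hd⟩ := exists_dual_family_of_nondegenerate (Q.comp VB.subtype)
    (fun v hv => Subtype.ext (hVB v v.2 fun w hw => hv ⟨w, hw⟩)) u hu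
  replace hd (i j) : polar Q (u j : V) (d i) = if i = j then 1 else 0 := hd i j
  let r (i : Fin l) : qRadical Q := (a i)⁻¹ • Y (d i)
  have hQr (i : Fin l) : Q (u i + r i) = (a i)⁻¹ := by
    have hrad : Q (r i) = (a i)⁻¹ + Q (u i) := by
      simp only [r, Submodule.coe_smul, QuadraticMap.map_smul, hYQ, hd, smul_eq_mul]
      rw [Finset.sum_eq_single i (fun j _ hj => by simp [hj.symm]) (by simp)]
      have := ha i
      simp only [if_true]
      field_simp
    rw [map_add_of_mem_qRadical (r i).2, hrad, add_left_comm, CharTwo.add_self_eq_zero, add_zero]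
  let E : VB →ₗ[k] VB := LinearMap.id +
    ∑ i, (polarBilin (Q.comp VB.subtype) (u i)).smulRight (d i)
  have hE (w : VB) : E w = w + ∑ i, polar Q (u i : V) w • d i := by
    simp [E]
    rfl
  have hEorth (w : VB) (j : Fin l) : polar Q (u j : V) (E w) = 0 := by
    rw [hE, Submodule.coe_add, AddSubmonoidClass.coe_finsetSum, polar_add_right,
      ← polarBilin_apply_apply Q _ (∑ i, _), map_sum]
    simp [hd, CharTwo.add_self_eq_zero]
  have hZQ (w : VB) : Q (Y (E w)) = 0 := by simp [hYQ, hEorth]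
  have hdecomp (v : V) : ∃ (w : VB) (g : qRadical Q), (w : V) + g = v := by
    obtain ⟨w, hw, g, hg, h⟩ := Submodule.mem_sup.1 (hc.sup_eq_top ▸ Submodule.mem_top : v ∈ _)
    exact ⟨⟨w, hw⟩, ⟨g, hg⟩, h⟩
  have hchar (v : V) : v + v = 0 := by rw [← two_smul k, CharTwo.two_eq_zero, zero_smul]
  let Θ₂ : Module.End k V := tripleMap VB (qRadical Q) hc LinearMap.id (Y ∘ₗ E) LinearMap.id
  let Θ₃ : Module.End k V := tripleMap VB (qRadical Q) hc LinearMap.id 0 ρ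
  have hΘ₂ (w : VB) (g : qRadical Q) : Θ₂ (w + g) = w + (Y (E w) + g : qRadical Q) :=
    tripleMap_apply_add ..
  have hΘ₃ (w : VB) (g : qRadical Q) : Θ₃ (w + g) = w + ρ g := by
    simpa using tripleMap_apply_add VB (qRadical Q) hc LinearMap.id 0 ρ w g
  refine ⟨fun i => u i + r i, Θ₂, Θ₃, hQr, ⟨?_, ?_, ?_, ?_⟩, ⟨?_, ?_, ?_, ?_⟩, ?_⟩
  · refine bijective_of_mul_self_eq_one (LinearMap.ext fun v => ?_)
    obtain ⟨w, g, rfl⟩ := hdecomp v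
    rw [Module.End.mul_apply, hΘ₂, hΘ₂, ← add_assoc, Module.End.one_apply]
    simp [hchar]
  · intro v
    obtain ⟨w, g, rfl⟩ := hdecomp v
    rw [hΘ₂, map_add_of_mem_qRadical (Submodule.coe_mem _), map_add_of_mem_qRadical g.2,
      Submodule.coe_add, map_add_of_mem_qRadical g.2, hZQ, zero_add]
  · intro v
    obtain ⟨w, g, rfl⟩ := hdecomp v
    have h : Θ₂ (w + g) + (w + g) = Y (E w) := by
      rw [hΘ₂, Submodule.coe_add, add_left_comm (w : V), add_assoc, hchar, add_zero]
    rw [h]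
    exact ⟨Submodule.coe_mem _, hZQ w⟩
  · intro g hg
    simpa using hΘ₂ 0 ⟨g, hg⟩
  · refine bijective_of_mul_self_eq_one (LinearMap.ext fun v => ?_)
    obtain ⟨w, g, rfl⟩ := hdecomp v
    rw [Module.End.mul_apply, hΘ₃, hΘ₃, hρ2, Module.End.one_apply]
  · intro v
    obtain ⟨w, g, rfl⟩ := hdecomp v
    rw [hΘ₃, map_add_of_mem_qRadical (ρ g).2, map_add_of_mem_qRadical g.2, hρQ]
  · intro w hw
    simpa using hΘ₃ ⟨w, hw⟩ 0
  · intro g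
    simpa using hΘ₃ 0 g
  · refine LinearMap.ext fun v => ?_
    obtain ⟨w, g, rfl⟩ := hdecomp v
    have hYr : Y (E w) + ∑ i, (a i * polar Q (u i : V) w) • r i = Y w := by
      have (i : Fin l) : (a i * polar Q (u i : V) w) • r i = polar Q (u i : V) w • Y (d i) := by
        rw [smul_smul, mul_right_comm, mul_inv_cancel₀ (ha i), one_mul]
      simp only [this, hE, map_add, map_sum, map_smul]
      rw [add_assoc, ← two_smul k (∑ i, _), CharTwo.two_eq_zero, zero_smul, add_zero]
    have hpolar (i : Fin l) (x : V) : polar Q (u i + r i : V) x = polar Q (u i : V) x := by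
      rw [polar_add_left, polar_of_mem_qRadical (r i).2, add_zero]
    simp only [orthTransvection, hQr, inv_inv]
    rw [Module.End.mul_apply, Module.End.mul_apply, hΘ₃, hΘ₂, key,
      prod_sympTransvection_apply _ _ _ fun i j hij => by
        rw [hpolar, polar_add_right, huB i j hij, polar_of_mem_qRadical_right (r j).2, add_zero],
      ← hYr]
    simp only [hpolar, polar_add_right, polar_of_mem_qRadical_right (Submodule.coe_mem _),
      add_zero, smul_add, Finset.sum_add_distrib, Submodule.coe_add,
      AddSubmonoidClass.coe_finsetSum, Submodule.coe_smul]
    abel
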